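/- Subject reduction for redex contraction in PCMLL: contracting any of the seven redexes of PCMLL yields a derivation of the same sequent with strictly fewer rules. The seven redexes are: an implication introduction \_i (resp. /_i, ⊸_i) whose conclusion is immediately the major premise of the corresponding elimination \_e (resp. /_e, ⊸_e), contracted by substituting the derivation of the minor premise for the discharged hypothesis; a ⊙_i (resp. ⊗_i) whose conclusion ⟨Δ1;Δ2⟩ ⊢ A⊙B (resp. (Δ1,Δ2) ⊢ A⊗B) is the left premise of a ⊙_e (resp. ⊗_e), contracted by substituting the derivations of Δ1 ⊢ A and Δ2 ⊢ B for the discharged hypotheses in the derivation of the right premise; and a ⊙_i (resp. ⊗_i) applied to two axioms whose conclusion ⟨A;B⟩ ⊢ A⊙B (resp. (A,B) ⊢ A⊗B) is the right premise of a ⊙_e (resp. ⊗_e), contracted to the derivation of the left premise. -/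

import Mathlib

/-!  Partially commutative multiplicative intuitionistic linear logic (PCMLL):
     formulas, series-parallel contexts, entropy, natural deduction
     derivations, principal branches, extended redexes, normal derivations. -/

/-- Formulas of PCMLL. -/
inductive Fm : Type
  | var   : ℕ → Fm
  | nprod : Fm → Fm → Fm   -- A ⊙ B (non-commutative product)
  | cprod : Fm → Fm → Fm   -- A ⊗ B (commutative product)
  | ldiv  : Fm → Fm → Fm   -- ldiv A C = A \ C
  | rdiv  : Fm → Fm → Fm   -- rdiv C A = C / A
  | limp  : Fm → Fm → Fm   -- limp A C = A ⊸ C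
  deriving DecidableEq

/-- Series-parallel contexts: single formulas, series composition `⟨Γ;Δ⟩`
and parallel composition `(Γ,Δ)`. -/
inductive Ctx : Type
  | leaf : Fm → Ctx
  | seq  : Ctx → Ctx → Ctx
  | par  : Ctx → Ctx → Ctx
  deriving DecidableEq

/-- The list of formula occurrences of a context, from left to right. -/
def leaves : Ctx → List Fm
  | .leaf A => [A]
  | .seq a b => leaves a ++ leaves b
  | .par a b => leaves a ++ leaves b

def nsize (Γ : Ctx) : ℕ := (leaves Γ).length

/-- The series-parallel strict order on the occurrences (numbered from left to
right) of a context: `i < j` iff their lowest common node is a series node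
with `i` on the left and `j` on the right. -/
def ctxLt : Ctx → ℕ → ℕ → Prop
  | .leaf _, _, _ => False
  | .seq a b, i, j =>
      (i < nsize a ∧ nsize a ≤ j ∧ j < nsize a + nsize b) ∨
      ctxLt a i j ∨
      (nsize a ≤ i ∧ nsize a ≤ j ∧ ctxLt b (i - nsize a) (j - nsize a))
  | .par a b, i, j =>
      ctxLt a i j ∨
      (nsize a ≤ i ∧ nsize a ≤ j ∧ ctxLt b (i - nsize a) (j - nsize a))

/-- Entropy `Γ' ⊑ Γ` : same underlying multiset of formulas and the order of
`Γ'` is included in the order of `Γ`. -/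
def SubOrder (Γ' Γ : Ctx) : Prop :=
  ∃ e : Fin (leaves Γ').length ≃ Fin (leaves Γ).length,
    (∀ i, (leaves Γ').get i = (leaves Γ).get (e i)) ∧
    (∀ i j : Fin (leaves Γ').length, ctxLt Γ' i j → ctxLt Γ (e i) (e j))

/-- One-hole contexts. -/
inductive CCtx : Type
  | hole : CCtx
  | seqL : CCtx → Ctx → CCtx
  | seqR : Ctx → CCtx → CCtx
  | parL : CCtx → Ctx → CCtx
  | parR : Ctx → CCtx → CCtx
  deriving DecidableEq

/-- Filling the hole of a one-hole context. -/
def fill : CCtx → Ctx → Ctx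
  | .hole, Δ => Δ
  | .seqL K b, Δ => .seq (fill K Δ) b
  | .seqR a K, Δ => .seq a (fill K Δ)
  | .parL K b, Δ => .par (fill K Δ) b
  | .parR a K, Δ => .par a (fill K Δ)

/-- Composition of one-hole contexts: `fill (ccomp K K') Δ = fill K (fill K' Δ)`. -/
def ccomp : CCtx → CCtx → CCtx
  | .hole, K => K
  | .seqL K₀ b, K => .seqL (ccomp K₀ K) b
  | .seqR a K₀, K => .seqR a (ccomp K₀ K)
  | .parL K₀ b, K => .parL (ccomp K₀ K) b
  | .parR a K₀, K => .parR a (ccomp K₀ K)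

/-- Natural deduction derivations of PCMLL. -/
inductive PDeriv : Ctx → Fm → Type
  | ax (A : Fm) : PDeriv (.leaf A) A
  | ldivE {Γ Δ : Ctx} {A C : Fm} :
      PDeriv Γ A → PDeriv Δ (Fm.ldiv A C) → PDeriv (.seq Γ Δ) C
  | rdivE {Δ Γ : Ctx} {A C : Fm} :
      PDeriv Δ (Fm.rdiv C A) → PDeriv Γ A → PDeriv (.seq Δ Γ) C
  | limpE {Γ Δ : Ctx} {A C : Fm} :
      PDeriv Γ A → PDeriv Δ (Fm.limp A C) → PDeriv (.par Γ Δ) C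
  | ldivI {Γ : Ctx} {A C : Fm} :
      PDeriv (.seq (.leaf A) Γ) C → PDeriv Γ (Fm.ldiv A C)
  | rdivI {Γ : Ctx} {A C : Fm} :
      PDeriv (.seq Γ (.leaf A)) C → PDeriv Γ (Fm.rdiv C A)
  | limpI {Γ : Ctx} {A C : Fm} :
      PDeriv (.par (.leaf A) Γ) C → PDeriv Γ (Fm.limp A C)
  | nprodI {Δ Γ : Ctx} {A B : Fm} :
      PDeriv Δ A → PDeriv Γ B → PDeriv (.seq Δ Γ) (Fm.nprod A B)
  | cprodI {Δ Γ : Ctx} {A B : Fm} :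
      PDeriv Δ A → PDeriv Γ B → PDeriv (.par Δ Γ) (Fm.cprod A B)
  | nprodE {Δ : Ctx} {A B : Fm} {K : CCtx} {C : Fm} :
      PDeriv Δ (Fm.nprod A B) →
      PDeriv (fill K (.seq (.leaf A) (.leaf B))) C → PDeriv (fill K Δ) C
  | cprodE {Δ : Ctx} {A B : Fm} {K : CCtx} {C : Fm} :
      PDeriv Δ (Fm.cprod A B) →
      PDeriv (fill K (.par (.leaf A) (.leaf B))) C → PDeriv (fill K Δ) C
  | entropy {Γ Γ' : Ctx} {C : Fm} :
      PDeriv Γ C → SubOrder Γ' Γ → PDeriv Γ' C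

/-- Names of the rules of PCMLL. -/
inductive Rule : Type
  | ax | ldivE | rdivE | limpE | ldivI | rdivI | limpI
  | nprodI | cprodI | nprodE | cprodE | entropy
  deriving DecidableEq

/-- A derivation together with its sequent. -/
abbrev PTree : Type := Σ (Γ : Ctx) (C : Fm), PDeriv Γ C

/-- The last rule of a derivation. -/
def lastRule : ∀ {Γ C}, PDeriv Γ C → Rule
  | _, _, .ax _ => .ax
  | _, _, .ldivE _ _ => .ldivE
  | _, _, .rdivE _ _ => .rdivE
  | _, _, .limpE _ _ => .limpE
  | _, _, .ldivI _ => .ldivI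
  | _, _, .rdivI _ => .rdivI
  | _, _, .limpI _ => .limpI
  | _, _, .nprodI _ _ => .nprodI
  | _, _, .cprodI _ _ => .cprodI
  | _, _, .nprodE _ _ => .nprodE
  | _, _, .cprodE _ _ => .cprodE
  | _, _, .entropy _ _ => .entropy

/-- The premises of the last rule of a derivation. -/
def premises : ∀ {Γ C}, PDeriv Γ C → List PTree
  | _, _, .ax _ => []
  | _, _, .ldivE d₁ d₂ => [⟨_, _, d₁⟩, ⟨_, _, d₂⟩]
  | _, _, .rdivE d₁ d₂ => [⟨_, _, d₁⟩, ⟨_, _, d₂⟩]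
  | _, _, .limpE d₁ d₂ => [⟨_, _, d₁⟩, ⟨_, _, d₂⟩]
  | _, _, .ldivI d => [⟨_, _, d⟩]
  | _, _, .rdivI d => [⟨_, _, d⟩]
  | _, _, .limpI d => [⟨_, _, d⟩]
  | _, _, .nprodI d₁ d₂ => [⟨_, _, d₁⟩, ⟨_, _, d₂⟩]
  | _, _, .cprodI d₁ d₂ => [⟨_, _, d₁⟩, ⟨_, _, d₂⟩]
  | _, _, .nprodE d₁ d₂ => [⟨_, _, d₁⟩, ⟨_, _, d₂⟩]
  | _, _, .cprodE d₁ d₂ => [⟨_, _, d₁⟩, ⟨_, _, d₂⟩]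
  | _, _, .entropy d _ => [⟨_, _, d⟩]

/-- The premise through which the principal branch continues: the premise of a
unary rule (introduction or entropy), the major premise of an implicative
elimination, the premise in which the hypotheses are discharged for a product
elimination. -/
def principalPremise : ∀ {Γ C}, PDeriv Γ C → Option PTree
  | _, _, .ax _ => none
  | _, _, .ldivE _ d₂ => some ⟨_, _, d₂⟩
  | _, _, .rdivE d₁ _ => some ⟨_, _, d₁⟩
  | _, _, .limpE _ d₂ => some ⟨_, _, d₂⟩
  | _, _, .ldivI d => some ⟨_, _, d⟩
  | _, _, .rdivI d => some ⟨_, _, d⟩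
  | _, _, .limpI d => some ⟨_, _, d⟩
  | _, _, .nprodI _ _ => none
  | _, _, .cprodI _ _ => none
  | _, _, .nprodE _ d₂ => some ⟨_, _, d₂⟩
  | _, _, .cprodE _ d₂ => some ⟨_, _, d₂⟩
  | _, _, .entropy d _ => some ⟨_, _, d⟩

/-- Number of rules in a derivation. -/
def psize : ∀ {Γ C}, PDeriv Γ C → ℕ
  | _, _, .ax _ => 1
  | _, _, .ldivE d₁ d₂ => psize d₁ + psize d₂ + 1
  | _, _, .rdivE d₁ d₂ => psize d₁ + psize d₂ + 1
  | _, _, .limpE d₁ d₂ => psize d₁ + psize d₂ + 1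
  | _, _, .ldivI d => psize d + 1
  | _, _, .rdivI d => psize d + 1
  | _, _, .limpI d => psize d + 1
  | _, _, .nprodI d₁ d₂ => psize d₁ + psize d₂ + 1
  | _, _, .cprodI d₁ d₂ => psize d₁ + psize d₂ + 1
  | _, _, .nprodE d₁ d₂ => psize d₁ + psize d₂ + 1
  | _, _, .cprodE d₁ d₂ => psize d₁ + psize d₂ + 1
  | _, _, .entropy d _ => psize d + 1

/-- All subderivations (occurrences of sequents) of a derivation. -/
def subtrees : ∀ {Γ C}, PDeriv Γ C → List PTree
  | _, _, .ax A => [⟨_, _, .ax A⟩]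
  | _, _, .ldivE d₁ d₂ => ⟨_, _, .ldivE d₁ d₂⟩ :: (subtrees d₁ ++ subtrees d₂)
  | _, _, .rdivE d₁ d₂ => ⟨_, _, .rdivE d₁ d₂⟩ :: (subtrees d₁ ++ subtrees d₂)
  | _, _, .limpE d₁ d₂ => ⟨_, _, .limpE d₁ d₂⟩ :: (subtrees d₁ ++ subtrees d₂)
  | _, _, .ldivI d => ⟨_, _, .ldivI d⟩ :: subtrees d
  | _, _, .rdivI d => ⟨_, _, .rdivI d⟩ :: subtrees d
  | _, _, .limpI d => ⟨_, _, .limpI d⟩ :: subtrees d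
  | _, _, .nprodI d₁ d₂ => ⟨_, _, .nprodI d₁ d₂⟩ :: (subtrees d₁ ++ subtrees d₂)
  | _, _, .cprodI d₁ d₂ => ⟨_, _, .cprodI d₁ d₂⟩ :: (subtrees d₁ ++ subtrees d₂)
  | _, _, .nprodE d₁ d₂ => ⟨_, _, .nprodE d₁ d₂⟩ :: (subtrees d₁ ++ subtrees d₂)
  | _, _, .cprodE d₁ d₂ => ⟨_, _, .cprodE d₁ d₂⟩ :: (subtrees d₁ ++ subtrees d₂)
  | _, _, .entropy d h => ⟨_, _, .entropy d h⟩ :: subtrees d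

/-- `stepN k d` goes `k` steps up the principal branch starting at `d`. -/
def stepN : ℕ → PTree → Option PTree
  | 0, d => some d
  | k + 1, d => (principalPremise d.2.2).bind (stepN k)

def ImpElim (r : Rule) : Prop := r = .ldivE ∨ r = .rdivE ∨ r = .limpE

def ProdElim (r : Rule) : Prop := r = .nprodE ∨ r = .cprodE

def IsElim (r : Rule) : Prop := ImpElim r ∨ ProdElim r

def IsIntro (r : Rule) : Prop :=
  r = .ldivI ∨ r = .rdivI ∨ r = .limpI ∨ r = .nprodI ∨ r = .cprodI

/-- There is a path of length `k` along the principal branch from `d₀` to the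
conclusion of an introduction rule with the same right-hand-side formula. -/
def ExtRedexFrom (k : ℕ) (d₀ : PTree) : Prop :=
  ∃ dk : PTree, stepN k d₀ = some dk ∧ IsIntro (lastRule dk.2.2) ∧ dk.2.1 = d₀.2.1

/-- The root of `d` is an elimination rule whose principal premise starts a
`k`-extended-redex. -/
def ExtRedexAt (k : ℕ) (d : PTree) : Prop :=
  IsElim (lastRule d.2.2) ∧
    ∃ d₀ : PTree, principalPremise d.2.2 = some d₀ ∧ ExtRedexFrom k d₀

/-- The derivation contains a `k`-extended-redex. -/
def HasExtRedex {Γ C} (k : ℕ) (δ : PDeriv Γ C) : Prop :=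
  ∃ d ∈ subtrees δ, ExtRedexAt k d

/-- A PCMLL derivation is normal if it contains no `k`-extended-redex for any `k`. -/
def NormalDeriv {Γ C} (δ : PDeriv Γ C) : Prop :=
  ∀ k, ¬ HasExtRedex k δ

/-- Subformula relation. -/
inductive Subf : Fm → Fm → Prop
  | refl (A : Fm) : Subf A A
  | nprodL {F A B} : Subf F A → Subf F (Fm.nprod A B)
  | nprodR {F A B} : Subf F B → Subf F (Fm.nprod A B)
  | cprodL {F A B} : Subf F A → Subf F (Fm.cprod A B)
  | cprodR {F A B} : Subf F B → Subf F (Fm.cprod A B)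
  | ldivL {F A B} : Subf F A → Subf F (Fm.ldiv A B)
  | ldivR {F A B} : Subf F B → Subf F (Fm.ldiv A B)
  | rdivL {F A B} : Subf F A → Subf F (Fm.rdiv A B)
  | rdivR {F A B} : Subf F B → Subf F (Fm.rdiv A B)
  | limpL {F A B} : Subf F A → Subf F (Fm.limp A B)
  | limpR {F A B} : Subf F B → Subf F (Fm.limp A B)

/-! Substitution of a derivation for a hypothesis occurrence in a PCMLL
derivation. -/

/-- `PSubst d e d'` : `d'` is obtained from the derivation `d` by replacing a
hypothesis occurrence (a leaf of its context, carrying the conclusion formula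
of `e`) by the derivation `e`. -/
inductive PSubst : PTree → PTree → PTree → Prop
  | ax {Δ : Ctx} {A : Fm} (e : PDeriv Δ A) :
      PSubst ⟨.leaf A, A, .ax A⟩ ⟨Δ, A, e⟩ ⟨Δ, A, e⟩
  | ldivE_l {Γ₁ Γ₁' Γ₂ Δ : Ctx} {X A C : Fm}
      {d₁ : PDeriv Γ₁ X} {d₂ : PDeriv Γ₂ (Fm.ldiv X C)} {e : PDeriv Δ A} {d₁' : PDeriv Γ₁' X} :
      PSubst ⟨Γ₁, X, d₁⟩ ⟨Δ, A, e⟩ ⟨Γ₁', X, d₁'⟩ →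
      PSubst ⟨.seq Γ₁ Γ₂, C, .ldivE d₁ d₂⟩ ⟨Δ, A, e⟩ ⟨.seq Γ₁' Γ₂, C, .ldivE d₁' d₂⟩
  | ldivE_r {Γ₁ Γ₂ Γ₂' Δ : Ctx} {X A C : Fm}
      {d₁ : PDeriv Γ₁ X} {d₂ : PDeriv Γ₂ (Fm.ldiv X C)} {e : PDeriv Δ A} {d₂' : PDeriv Γ₂' (Fm.ldiv X C)} :
      PSubst ⟨Γ₂, Fm.ldiv X C, d₂⟩ ⟨Δ, A, e⟩ ⟨Γ₂', Fm.ldiv X C, d₂'⟩ →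
      PSubst ⟨.seq Γ₁ Γ₂, C, .ldivE d₁ d₂⟩ ⟨Δ, A, e⟩ ⟨.seq Γ₁ Γ₂', C, .ldivE d₁ d₂'⟩
  | rdivE_l {Γ₁ Γ₁' Γ₂ Δ : Ctx} {X A C : Fm}
      {d₁ : PDeriv Γ₁ (Fm.rdiv C X)} {d₂ : PDeriv Γ₂ X} {e : PDeriv Δ A} {d₁' : PDeriv Γ₁' (Fm.rdiv C X)} :
      PSubst ⟨Γ₁, Fm.rdiv C X, d₁⟩ ⟨Δ, A, e⟩ ⟨Γ₁', Fm.rdiv C X, d₁'⟩ →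
      PSubst ⟨.seq Γ₁ Γ₂, C, .rdivE d₁ d₂⟩ ⟨Δ, A, e⟩ ⟨.seq Γ₁' Γ₂, C, .rdivE d₁' d₂⟩
  | rdivE_r {Γ₁ Γ₂ Γ₂' Δ : Ctx} {X A C : Fm}
      {d₁ : PDeriv Γ₁ (Fm.rdiv C X)} {d₂ : PDeriv Γ₂ X} {e : PDeriv Δ A} {d₂' : PDeriv Γ₂' X} :
      PSubst ⟨Γ₂, X, d₂⟩ ⟨Δ, A, e⟩ ⟨Γ₂', X, d₂'⟩ →
      PSubst ⟨.seq Γ₁ Γ₂, C, .rdivE d₁ d₂⟩ ⟨Δ, A, e⟩ ⟨.seq Γ₁ Γ₂', C, .rdivE d₁ d₂'⟩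
  | limpE_l {Γ₁ Γ₁' Γ₂ Δ : Ctx} {X A C : Fm}
      {d₁ : PDeriv Γ₁ X} {d₂ : PDeriv Γ₂ (Fm.limp X C)} {e : PDeriv Δ A} {d₁' : PDeriv Γ₁' X} :
      PSubst ⟨Γ₁, X, d₁⟩ ⟨Δ, A, e⟩ ⟨Γ₁', X, d₁'⟩ →
      PSubst ⟨.par Γ₁ Γ₂, C, .limpE d₁ d₂⟩ ⟨Δ, A, e⟩ ⟨.par Γ₁' Γ₂, C, .limpE d₁' d₂⟩
  | limpE_r {Γ₁ Γ₂ Γ₂' Δ : Ctx} {X A C : Fm}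
      {d₁ : PDeriv Γ₁ X} {d₂ : PDeriv Γ₂ (Fm.limp X C)} {e : PDeriv Δ A} {d₂' : PDeriv Γ₂' (Fm.limp X C)} :
      PSubst ⟨Γ₂, Fm.limp X C, d₂⟩ ⟨Δ, A, e⟩ ⟨Γ₂', Fm.limp X C, d₂'⟩ →
      PSubst ⟨.par Γ₁ Γ₂, C, .limpE d₁ d₂⟩ ⟨Δ, A, e⟩ ⟨.par Γ₁ Γ₂', C, .limpE d₁ d₂'⟩
  | ldivI {Γ Γ' Δ : Ctx} {A B C : Fm}
      {d : PDeriv (.seq (.leaf A) Γ) C} {d' : PDeriv (.seq (.leaf A) Γ') C} {e : PDeriv Δ B} :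
      PSubst ⟨.seq (.leaf A) Γ, C, d⟩ ⟨Δ, B, e⟩ ⟨.seq (.leaf A) Γ', C, d'⟩ →
      PSubst ⟨Γ, Fm.ldiv A C, .ldivI d⟩ ⟨Δ, B, e⟩ ⟨Γ', Fm.ldiv A C, .ldivI d'⟩
  | rdivI {Γ Γ' Δ : Ctx} {A B C : Fm}
      {d : PDeriv (.seq Γ (.leaf A)) C} {d' : PDeriv (.seq Γ' (.leaf A)) C} {e : PDeriv Δ B} :
      PSubst ⟨.seq Γ (.leaf A), C, d⟩ ⟨Δ, B, e⟩ ⟨.seq Γ' (.leaf A), C, d'⟩ →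
      PSubst ⟨Γ, Fm.rdiv C A, .rdivI d⟩ ⟨Δ, B, e⟩ ⟨Γ', Fm.rdiv C A, .rdivI d'⟩
  | limpI {Γ Γ' Δ : Ctx} {A B C : Fm}
      {d : PDeriv (.par (.leaf A) Γ) C} {d' : PDeriv (.par (.leaf A) Γ') C} {e : PDeriv Δ B} :
      PSubst ⟨.par (.leaf A) Γ, C, d⟩ ⟨Δ, B, e⟩ ⟨.par (.leaf A) Γ', C, d'⟩ →
      PSubst ⟨Γ, Fm.limp A C, .limpI d⟩ ⟨Δ, B, e⟩ ⟨Γ', Fm.limp A C, .limpI d'⟩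
  | nprodI_l {Γ₁ Γ₁' Γ₂ Δ : Ctx} {X Y A : Fm}
      {d₁ : PDeriv Γ₁ X} {d₂ : PDeriv Γ₂ Y} {e : PDeriv Δ A} {d₁' : PDeriv Γ₁' X} :
      PSubst ⟨Γ₁, X, d₁⟩ ⟨Δ, A, e⟩ ⟨Γ₁', X, d₁'⟩ →
      PSubst ⟨.seq Γ₁ Γ₂, Fm.nprod X Y, .nprodI d₁ d₂⟩ ⟨Δ, A, e⟩
        ⟨.seq Γ₁' Γ₂, Fm.nprod X Y, .nprodI d₁' d₂⟩
  | nprodI_r {Γ₁ Γ₂ Γ₂' Δ : Ctx} {X Y A : Fm}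
      {d₁ : PDeriv Γ₁ X} {d₂ : PDeriv Γ₂ Y} {e : PDeriv Δ A} {d₂' : PDeriv Γ₂' Y} :
      PSubst ⟨Γ₂, Y, d₂⟩ ⟨Δ, A, e⟩ ⟨Γ₂', Y, d₂'⟩ →
      PSubst ⟨.seq Γ₁ Γ₂, Fm.nprod X Y, .nprodI d₁ d₂⟩ ⟨Δ, A, e⟩
        ⟨.seq Γ₁ Γ₂', Fm.nprod X Y, .nprodI d₁ d₂'⟩
  | cprodI_l {Γ₁ Γ₁' Γ₂ Δ : Ctx} {X Y A : Fm}
      {d₁ : PDeriv Γ₁ X} {d₂ : PDeriv Γ₂ Y} {e : PDeriv Δ A} {d₁' : PDeriv Γ₁' X} :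
      PSubst ⟨Γ₁, X, d₁⟩ ⟨Δ, A, e⟩ ⟨Γ₁', X, d₁'⟩ →
      PSubst ⟨.par Γ₁ Γ₂, Fm.cprod X Y, .cprodI d₁ d₂⟩ ⟨Δ, A, e⟩
        ⟨.par Γ₁' Γ₂, Fm.cprod X Y, .cprodI d₁' d₂⟩
  | cprodI_r {Γ₁ Γ₂ Γ₂' Δ : Ctx} {X Y A : Fm}
      {d₁ : PDeriv Γ₁ X} {d₂ : PDeriv Γ₂ Y} {e : PDeriv Δ A} {d₂' : PDeriv Γ₂' Y} :
      PSubst ⟨Γ₂, Y, d₂⟩ ⟨Δ, A, e⟩ ⟨Γ₂', Y, d₂'⟩ →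
      PSubst ⟨.par Γ₁ Γ₂, Fm.cprod X Y, .cprodI d₁ d₂⟩ ⟨Δ, A, e⟩
        ⟨.par Γ₁ Γ₂', Fm.cprod X Y, .cprodI d₁ d₂'⟩
  | nprodE_l {Δ₀ Δ₀' Δ : Ctx} {A B X C : Fm} {K : CCtx}
      {d₀ : PDeriv Δ₀ (Fm.nprod A B)} {dr : PDeriv (fill K (.seq (.leaf A) (.leaf B))) C}
      {e : PDeriv Δ X} {d₀' : PDeriv Δ₀' (Fm.nprod A B)} :
      PSubst ⟨Δ₀, Fm.nprod A B, d₀⟩ ⟨Δ, X, e⟩ ⟨Δ₀', Fm.nprod A B, d₀'⟩ →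
      PSubst ⟨fill K Δ₀, C, .nprodE d₀ dr⟩ ⟨Δ, X, e⟩ ⟨fill K Δ₀', C, .nprodE d₀' dr⟩
  | nprodE_r {Δ₀ Δ : Ctx} {A B X C : Fm} {K K' : CCtx}
      {d₀ : PDeriv Δ₀ (Fm.nprod A B)} {dr : PDeriv (fill K (.seq (.leaf A) (.leaf B))) C}
      {e : PDeriv Δ X} {dr' : PDeriv (fill K' (.seq (.leaf A) (.leaf B))) C} :
      PSubst ⟨fill K (.seq (.leaf A) (.leaf B)), C, dr⟩ ⟨Δ, X, e⟩
        ⟨fill K' (.seq (.leaf A) (.leaf B)), C, dr'⟩ →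
      PSubst ⟨fill K Δ₀, C, .nprodE d₀ dr⟩ ⟨Δ, X, e⟩ ⟨fill K' Δ₀, C, .nprodE d₀ dr'⟩
  | cprodE_l {Δ₀ Δ₀' Δ : Ctx} {A B X C : Fm} {K : CCtx}
      {d₀ : PDeriv Δ₀ (Fm.cprod A B)} {dr : PDeriv (fill K (.par (.leaf A) (.leaf B))) C}
      {e : PDeriv Δ X} {d₀' : PDeriv Δ₀' (Fm.cprod A B)} :
      PSubst ⟨Δ₀, Fm.cprod A B, d₀⟩ ⟨Δ, X, e⟩ ⟨Δ₀', Fm.cprod A B, d₀'⟩ →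
      PSubst ⟨fill K Δ₀, C, .cprodE d₀ dr⟩ ⟨Δ, X, e⟩ ⟨fill K Δ₀', C, .cprodE d₀' dr⟩
  | cprodE_r {Δ₀ Δ : Ctx} {A B X C : Fm} {K K' : CCtx}
      {d₀ : PDeriv Δ₀ (Fm.cprod A B)} {dr : PDeriv (fill K (.par (.leaf A) (.leaf B))) C}
      {e : PDeriv Δ X} {dr' : PDeriv (fill K' (.par (.leaf A) (.leaf B))) C} :
      PSubst ⟨fill K (.par (.leaf A) (.leaf B)), C, dr⟩ ⟨Δ, X, e⟩
        ⟨fill K' (.par (.leaf A) (.leaf B)), C, dr'⟩ →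
      PSubst ⟨fill K Δ₀, C, .cprodE d₀ dr⟩ ⟨Δ, X, e⟩ ⟨fill K' Δ₀, C, .cprodE d₀ dr'⟩
  | entropy {Γ Γ' Γ'' Γ''' Δ : Ctx} {A C : Fm}
      {d : PDeriv Γ C} (h : SubOrder Γ' Γ) {d' : PDeriv Γ'' C} (h' : SubOrder Γ''' Γ'')
      {e : PDeriv Δ A} :
      PSubst ⟨Γ, C, d⟩ ⟨Δ, A, e⟩ ⟨Γ'', C, d'⟩ →
      PSubst ⟨Γ', C, .entropy d h⟩ ⟨Δ, A, e⟩ ⟨Γ''', C, .entropy d' h'⟩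

def SPos : Ctx → Type
  | .leaf _ => Unit
  | .seq a b => SPos a ⊕ SPos b
  | .par a b => SPos a ⊕ SPos b

def sU (A : Fm) : SPos (.leaf A) := ()

def SLab : (Γ : Ctx) → SPos Γ → Fm
  | .leaf A, _ => A
  | .seq a _, .inl p => SLab a p
  | .seq _ b, .inr p => SLab b p
  | .par a _, .inl p => SLab a p
  | .par _ b, .inr p => SLab b p

def SLt : (Γ : Ctx) → SPos Γ → SPos Γ → Prop
  | .leaf _, _, _ => False
  | .seq a _, .inl p, .inl q => SLt a p q
  | .seq _ _, .inl _, .inr _ => True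
  | .seq _ _, .inr _, .inl _ => False
  | .seq _ b, .inr p, .inr q => SLt b p q
  | .par a _, .inl p, .inl q => SLt a p q
  | .par _ _, .inl _, .inr _ => False
  | .par _ _, .inr _, .inl _ => False
  | .par _ b, .inr p, .inr q => SLt b p q

def SIdx : (Γ : Ctx) → SPos Γ → ℕ
  | .leaf _, _ => 0
  | .seq a _, .inl p => SIdx a p
  | .seq a b, .inr p => nsize a + SIdx b p
  | .par a _, .inl p => SIdx a p
  | .par a b, .inr p => nsize a + SIdx b p

theorem nsize_leaf (A : Fm) : nsize (.leaf A) = 1 := rfl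
theorem nsize_seq (a b : Ctx) : nsize (.seq a b) = nsize a + nsize b := by
  simp [nsize, leaves]
theorem nsize_par (a b : Ctx) : nsize (.par a b) = nsize a + nsize b := by
  simp [nsize, leaves]

theorem SIdx_lt (Γ : Ctx) (p : SPos Γ) : SIdx Γ p < nsize Γ := by
  induction Γ with
  | leaf A => simp [SIdx, nsize_leaf]
  | seq a b iha ihb =>
    rw [nsize_seq]
    rcases p with p | p
    · have := iha p; simp only [SIdx]; omega
    · have := ihb p; simp only [SIdx]; omega
  | par a b iha ihb =>
    rw [nsize_par]
    rcases p with p | p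
    · have := iha p; simp only [SIdx]; omega
    · have := ihb p; simp only [SIdx]; omega

theorem SIdx_inj (Γ : Ctx) (p q : SPos Γ) (h : SIdx Γ p = SIdx Γ q) : p = q := by
  induction Γ with
  | leaf A => rfl
  | seq a b iha ihb =>
    rcases p with p | p <;> rcases q with q | q <;> simp only [SIdx] at h
    · rw [iha p q h]
    · have := SIdx_lt a p; omega
    · have := SIdx_lt a q; omega
    · rw [ihb p q (by omega)]
  | par a b iha ihb =>
    rcases p with p | p <;> rcases q with q | q <;> simp only [SIdx] at h
    · rw [iha p q h]
    · have := SIdx_lt a p; omega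
    · have := SIdx_lt a q; omega
    · rw [ihb p q (by omega)]

theorem SIdx_surj (Γ : Ctx) (n : ℕ) (h : n < nsize Γ) : ∃ p, SIdx Γ p = n := by
  induction Γ generalizing n with
  | leaf A => rw [nsize_leaf] at h; exact ⟨(), by simp only [SIdx]; omega⟩
  | seq a b iha ihb =>
    rw [nsize_seq] at h
    by_cases hn : n < nsize a
    · obtain ⟨p, hp⟩ := iha n hn
      exact ⟨.inl p, hp⟩
    · obtain ⟨p, hp⟩ := ihb (n - nsize a) (by omega)
      exact ⟨.inr p, by simp only [SIdx]; omega⟩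
  | par a b iha ihb =>
    rw [nsize_par] at h
    by_cases hn : n < nsize a
    · obtain ⟨p, hp⟩ := iha n hn
      exact ⟨.inl p, hp⟩
    · obtain ⟨p, hp⟩ := ihb (n - nsize a) (by omega)
      exact ⟨.inr p, by simp only [SIdx]; omega⟩

theorem SLab_idx (Γ : Ctx) (p : SPos Γ) : (leaves Γ)[SIdx Γ p]? = some (SLab Γ p) := by
  induction Γ with
  | leaf A => rfl
  | seq a b iha ihb =>
    rcases p with p | p
    · have := SIdx_lt a p
      simp only [leaves, SIdx, SLab]
      rw [List.getElem?_append_left this, iha]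
    · simp only [leaves, SIdx, SLab]
      rw [List.getElem?_append_right (by simp [nsize])]
      simp only [nsize, Nat.add_sub_cancel_left, ihb]
  | par a b iha ihb =>
    rcases p with p | p
    · have := SIdx_lt a p
      simp only [leaves, SIdx, SLab]
      rw [List.getElem?_append_left this, iha]
    · simp only [leaves, SIdx, SLab]
      rw [List.getElem?_append_right (by simp [nsize])]
      simp only [nsize, Nat.add_sub_cancel_left, ihb]

theorem ctxLt_bound (Γ : Ctx) (i j : ℕ) (h : ctxLt Γ i j) : i < nsize Γ ∧ j < nsize Γ := by
  induction Γ generalizing i j with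
  | leaf A => exact h.elim
  | seq a b iha ihb =>
    rw [nsize_seq]
    rcases h with h | h | ⟨h1, h2, h⟩
    · omega
    · have := iha _ _ h; omega
    · have := ihb _ _ h; omega
  | par a b iha ihb =>
    rw [nsize_par]
    rcases h with h | ⟨h1, h2, h⟩
    · have := iha _ _ h; omega
    · have := ihb _ _ h; omega

theorem SLt_idx (Γ : Ctx) (p q : SPos Γ) : ctxLt Γ (SIdx Γ p) (SIdx Γ q) ↔ SLt Γ p q := by
  induction Γ with
  | leaf A => exact Iff.rfl
  | seq a b iha ihb =>
    rcases p with p | p <;> rcases q with q | q <;> simp only [ctxLt, SIdx, SLt]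
    · have h1 := SIdx_lt a p
      have h2 := SIdx_lt a q
      rw [← iha]
      constructor
      · rintro (h | h | h)
        · omega
        · exact h
        · omega
      · exact fun h => .inr (.inl h)
    · have h1 := SIdx_lt a p
      have h2 := SIdx_lt b q
      simp only [iff_true]
      left; omega
    · have h1 := SIdx_lt a q
      simp only [iff_false]
      rintro (h | h | h)
      · omega
      · have := ctxLt_bound _ _ _ h; omega
      · omega
    · rw [← ihb]
      constructor
      · rintro (h | h | h)
        · omega
        · have := ctxLt_bound _ _ _ h; omega
        · simpa using h.2.2
      · exact fun h => .inr (.inr ⟨by omega, by omega, by simpa using h⟩)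
  | par a b iha ihb =>
    rcases p with p | p <;> rcases q with q | q <;> simp only [ctxLt, SIdx, SLt]
    · have h1 := SIdx_lt a p
      have h2 := SIdx_lt a q
      rw [← iha]
      constructor
      · rintro (h | h)
        · exact h
        · omega
      · exact fun h => .inl h
    · have h1 := SIdx_lt a p
      simp only [iff_false]
      rintro (h | h)
      · have := ctxLt_bound _ _ _ h; omega
      · omega
    · have h1 := SIdx_lt a q
      simp only [iff_false]
      rintro (h | h)
      · have := ctxLt_bound _ _ _ h; omega
      · omega
    · rw [← ihb]
      constructor
      · rintro (h | h)
        · have := ctxLt_bound _ _ _ h; omega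
        · simpa using h.2.2
      · exact fun h => .inr ⟨by omega, by omega, by simpa using h⟩

noncomputable def SEquiv (Γ : Ctx) : SPos Γ ≃ Fin (leaves Γ).length :=
  Equiv.ofBijective (fun p => ⟨SIdx Γ p, SIdx_lt Γ p⟩)
    ⟨fun p q h => SIdx_inj Γ p q (congrArg Fin.val h), fun n => by
      obtain ⟨p, hp⟩ := SIdx_surj Γ n.1 n.2
      exact ⟨p, Fin.ext hp⟩⟩

theorem SEquiv_val (Γ : Ctx) (p : SPos Γ) : (SEquiv Γ p : ℕ) = SIdx Γ p := rfl

theorem SEquiv_get (Γ : Ctx) (p : SPos Γ) : (leaves Γ).get (SEquiv Γ p) = SLab Γ p := by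
  have h := SLab_idx Γ p
  have h2 := List.getElem?_eq_getElem (SEquiv Γ p).2
  exact (Option.some.inj (h.symm.trans h2)).symm

theorem subOrder_iff (Γ' Γ : Ctx) : SubOrder Γ' Γ ↔
    ∃ e : SPos Γ' ≃ SPos Γ, (∀ p, SLab Γ' p = SLab Γ (e p)) ∧
      ∀ p q, SLt Γ' p q → SLt Γ (e p) (e q) := by
  constructor
  · rintro ⟨e, h1, h2⟩
    refine ⟨(SEquiv Γ').trans (e.trans (SEquiv Γ).symm), fun p => ?_, fun p q h => ?_⟩
    · rw [← SEquiv_get, ← SEquiv_get]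
      simpa using h1 (SEquiv Γ' p)
    · rw [← SLt_idx, ← SEquiv_val, ← SEquiv_val]
      rw [← SLt_idx, ← SEquiv_val, ← SEquiv_val] at h
      simpa using h2 _ _ h
  · rintro ⟨e, h1, h2⟩
    refine ⟨(SEquiv Γ').symm.trans (e.trans (SEquiv Γ)), fun i => ?_, fun i j h => ?_⟩
    · obtain ⟨p, rfl⟩ := (SEquiv Γ').surjective i
      simp only [Equiv.trans_apply, Equiv.symm_apply_apply]
      rw [SEquiv_get, SEquiv_get, h1]
    · obtain ⟨p, rfl⟩ := (SEquiv Γ').surjective i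
      obtain ⟨q, rfl⟩ := (SEquiv Γ').surjective j
      simp only [Equiv.trans_apply, Equiv.symm_apply_apply]
      rw [SEquiv_val, SEquiv_val, SLt_idx] at h ⊢
      exact h2 _ _ h

def KPos : CCtx → Type
  | .hole => Empty
  | .seqL K b => KPos K ⊕ SPos b
  | .seqR a K => SPos a ⊕ KPos K
  | .parL K b => KPos K ⊕ SPos b
  | .parR a K => SPos a ⊕ KPos K

def inK : (K : CCtx) → (Δ : Ctx) → KPos K → SPos (fill K Δ)
  | .hole, _, k => nomatch k
  | .seqL K Δ', Δ, .inl k => (.inl (inK K Δ k) : SPos (fill K Δ) ⊕ SPos Δ')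
  | .seqL K Δ', Δ, .inr k => (.inr k : SPos (fill K Δ) ⊕ SPos Δ')
  | .seqR Δ' _, _, .inl k => (.inl k : SPos Δ' ⊕ _)
  | .seqR Δ' K, Δ, .inr k => (.inr (inK K Δ k) : SPos Δ' ⊕ _)
  | .parL K Δ', Δ, .inl k => (.inl (inK K Δ k) : SPos (fill K Δ) ⊕ SPos Δ')
  | .parL K Δ', Δ, .inr k => (.inr k : SPos (fill K Δ) ⊕ SPos Δ')
  | .parR Δ' _, _, .inl k => (.inl k : SPos Δ' ⊕ _)
  | .parR Δ' K, Δ, .inr k => (.inr (inK K Δ k) : SPos Δ' ⊕ _)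

def inD : (K : CCtx) → (Δ : Ctx) → SPos Δ → SPos (fill K Δ)
  | .hole, _, p => p
  | .seqL K Δ', Δ, p => (.inl (inD K Δ p) : SPos (fill K Δ) ⊕ SPos Δ')
  | .seqR Δ' K, Δ, p => (.inr (inD K Δ p) : SPos Δ' ⊕ SPos (fill K Δ))
  | .parL K Δ', Δ, p => (.inl (inD K Δ p) : SPos (fill K Δ) ⊕ SPos Δ')
  | .parR Δ' K, Δ, p => (.inr (inD K Δ p) : SPos Δ' ⊕ SPos (fill K Δ))

theorem inD_inj (K : CCtx) (Δ : Ctx) : Function.Injective (inD K Δ) := by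
  induction K with
  | hole => exact fun _ _ h => h
  | seqL K b ih => exact fun p q h => ih (Sum.inl_injective h)
  | seqR a K ih => exact fun p q h => ih (Sum.inr_injective h)
  | parL K b ih => exact fun p q h => ih (Sum.inl_injective h)
  | parR a K ih => exact fun p q h => ih (Sum.inr_injective h)

theorem inK_inj (K : CCtx) (Δ : Ctx) : Function.Injective (inK K Δ) := by
  induction K with
  | hole => exact fun p _ _ => nomatch p
  | seqL K b ih =>
    rintro (p | p) (q | q) h
    · exact congrArg Sum.inl (ih (Sum.inl_injective h))
    · cases h
    · cases h
    · exact congrArg Sum.inr (Sum.inr_injective h)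
  | parL K b ih =>
    rintro (p | p) (q | q) h
    · exact congrArg Sum.inl (ih (Sum.inl_injective h))
    · cases h
    · cases h
    · exact congrArg Sum.inr (Sum.inr_injective h)
  | seqR a K ih =>
    rintro (p | p) (q | q) h
    · exact congrArg Sum.inl (Sum.inl_injective h)
    · cases h
    · cases h
    · exact congrArg Sum.inr (ih (Sum.inr_injective h))
  | parR a K ih =>
    rintro (p | p) (q | q) h
    · exact congrArg Sum.inl (Sum.inl_injective h)
    · cases h
    · cases h
    · exact congrArg Sum.inr (ih (Sum.inr_injective h))

theorem inK_ne_inD (K : CCtx) (Δ : Ctx) (k : KPos K) (p : SPos Δ) : inK K Δ k ≠ inD K Δ p := by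
  induction K with
  | hole => exact nomatch k
  | seqL K b ih =>
    rcases k with k | k
    · exact fun h => ih k (Sum.inl_injective h)
    · exact fun h => nomatch h
  | parL K b ih =>
    rcases k with k | k
    · exact fun h => ih k (Sum.inl_injective h)
    · exact fun h => nomatch h
  | seqR a K ih =>
    rcases k with k | k
    · exact fun h => nomatch h
    · exact fun h => ih k (Sum.inr_injective h)
  | parR a K ih =>
    rcases k with k | k
    · exact fun h => nomatch h
    · exact fun h => ih k (Sum.inr_injective h)

theorem in_surj (K : CCtx) (Δ : Ctx) (x : SPos (fill K Δ)) :
    (∃ k, x = inK K Δ k) ∨ ∃ p, x = inD K Δ p := by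
  induction K with
  | hole => exact .inr ⟨x, rfl⟩
  | seqL K b ih =>
    rcases x with x | x
    · rcases ih x with ⟨k, rfl⟩ | ⟨p, rfl⟩
      · exact .inl ⟨.inl k, rfl⟩
      · exact .inr ⟨p, rfl⟩
    · exact .inl ⟨.inr x, rfl⟩
  | parL K b ih =>
    rcases x with x | x
    · rcases ih x with ⟨k, rfl⟩ | ⟨p, rfl⟩
      · exact .inl ⟨.inl k, rfl⟩
      · exact .inr ⟨p, rfl⟩
    · exact .inl ⟨.inr x, rfl⟩
  | seqR a K ih =>
    rcases x with x | x
    · exact .inl ⟨.inl x, rfl⟩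
    · rcases ih x with ⟨k, rfl⟩ | ⟨p, rfl⟩
      · exact .inl ⟨.inr k, rfl⟩
      · exact .inr ⟨p, rfl⟩
  | parR a K ih =>
    rcases x with x | x
    · exact .inl ⟨.inl x, rfl⟩
    · rcases ih x with ⟨k, rfl⟩ | ⟨p, rfl⟩
      · exact .inl ⟨.inr k, rfl⟩
      · exact .inr ⟨p, rfl⟩

theorem SLab_inD (K : CCtx) (Δ : Ctx) (p : SPos Δ) :
    SLab (fill K Δ) (inD K Δ p) = SLab Δ p := by
  induction K with
  | hole => rfl
  | _ => assumption

theorem SLab_inK (K : CCtx) (Δ Δ' : Ctx) (k : KPos K) :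
    SLab (fill K Δ) (inK K Δ k) = SLab (fill K Δ') (inK K Δ' k) := by
  induction K with
  | hole => exact nomatch k
  | seqL K b ih => rcases k with k | k; exacts [ih k, rfl]
  | parL K b ih => rcases k with k | k; exacts [ih k, rfl]
  | seqR K b ih => rcases k with k | k; exacts [rfl, ih k]
  | parR K b ih => rcases k with k | k; exacts [rfl, ih k]

theorem SLt_DD (K : CCtx) (Δ : Ctx) (p q : SPos Δ) :
    SLt (fill K Δ) (inD K Δ p) (inD K Δ q) ↔ SLt Δ p q := by
  induction K with
  | hole => rfl
  | _ => assumption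

theorem SLt_KK (K : CCtx) (Δ Δ' : Ctx) (k l : KPos K) :
    SLt (fill K Δ) (inK K Δ k) (inK K Δ l) ↔ SLt (fill K Δ') (inK K Δ' k) (inK K Δ' l) := by
  induction K with
  | hole => exact nomatch k
  | seqL K b ih =>
    rcases k with k | k <;> rcases l with l | l
    exacts [ih k l, Iff.rfl, Iff.rfl, Iff.rfl]
  | parL K b ih =>
    rcases k with k | k <;> rcases l with l | l
    exacts [ih k l, Iff.rfl, Iff.rfl, Iff.rfl]
  | seqR a K ih =>
    rcases k with k | k <;> rcases l with l | l
    exacts [Iff.rfl, Iff.rfl, Iff.rfl, ih k l]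
  | parR a K ih =>
    rcases k with k | k <;> rcases l with l | l
    exacts [Iff.rfl, Iff.rfl, Iff.rfl, ih k l]

theorem SLt_KD (K : CCtx) (Δ Δ' : Ctx) (k : KPos K) (p : SPos Δ) (p' : SPos Δ') :
    SLt (fill K Δ) (inK K Δ k) (inD K Δ p) ↔ SLt (fill K Δ') (inK K Δ' k) (inD K Δ' p') := by
  induction K with
  | hole => exact nomatch k
  | seqL K b ih => rcases k with k | k; exacts [ih k, Iff.rfl]
  | parL K b ih => rcases k with k | k; exacts [ih k, Iff.rfl]
  | seqR K b ih => rcases k with k | k; exacts [Iff.rfl, ih k]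
  | parR K b ih => rcases k with k | k; exacts [Iff.rfl, ih k]

theorem SLt_DK (K : CCtx) (Δ Δ' : Ctx) (k : KPos K) (p : SPos Δ) (p' : SPos Δ') :
    SLt (fill K Δ) (inD K Δ p) (inK K Δ k) ↔ SLt (fill K Δ') (inD K Δ' p') (inK K Δ' k) := by
  induction K with
  | hole => exact nomatch k
  | seqL K b ih => rcases k with k | k; exacts [ih k, Iff.rfl]
  | parL K b ih => rcases k with k | k; exacts [ih k, Iff.rfl]
  | seqR K b ih => rcases k with k | k; exacts [Iff.rfl, ih k]
  | parR K b ih => rcases k with k | k; exacts [Iff.rfl, ih k]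

noncomputable def fillEquiv (K : CCtx) (Δ : Ctx) : KPos K ⊕ SPos Δ ≃ SPos (fill K Δ) :=
  Equiv.ofBijective (Sum.elim (inK K Δ) (inD K Δ))
    ⟨Function.Injective.sumElim (inK_inj K Δ) (inD_inj K Δ) (inK_ne_inD K Δ), fun x => by
      rcases in_surj K Δ x with ⟨k, rfl⟩ | ⟨p, rfl⟩
      · exact ⟨.inl k, rfl⟩
      · exact ⟨.inr p, rfl⟩⟩

theorem pos_decomp (Γ : Ctx) (p : SPos Γ) : ∃ (K : CCtx) (A : Fm),
    (⟨Γ, p⟩ : Σ Γ, SPos Γ) = ⟨fill K (.leaf A), inD K (.leaf A) (sU A)⟩ := by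
  induction Γ with
  | leaf A => exact ⟨.hole, A, rfl⟩
  | seq a b iha ihb =>
    rcases p with p | p
    · obtain ⟨K, A, h⟩ := iha p
      cases h
      exact ⟨.seqL K b, A, rfl⟩
    · obtain ⟨K, A, h⟩ := ihb p
      cases h
      exact ⟨.seqR a K, A, rfl⟩
  | par a b iha ihb =>
    rcases p with p | p
    · obtain ⟨K, A, h⟩ := iha p
      cases h
      exact ⟨.parL K b, A, rfl⟩
    · obtain ⟨K, A, h⟩ := ihb p
      cases h
      exact ⟨.parR a K, A, rfl⟩

theorem subOrder_subst (K : CCtx) (A : Fm) (Γ Δ : Ctx) (h : SubOrder (fill K (.leaf A)) Γ) :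
    ∃ K₁, Γ = fill K₁ (.leaf A) ∧ SubOrder (fill K Δ) (fill K₁ Δ) := by
  rw [subOrder_iff] at h
  obtain ⟨e, h1, h2⟩ := h
  obtain ⟨p, hp⟩ : ∃ p, p = e (inD K (.leaf A) (sU A)) := ⟨_, rfl⟩
  obtain ⟨K₁, B, hd⟩ := pos_decomp Γ p
  cases hd
  have hAB : A = B := by
    have := h1 (inD K (.leaf A) (sU A))
    rw [← hp, SLab_inD, SLab_inD] at this
    exact this
  subst hAB
  refine ⟨K₁, rfl, ?_⟩
  rw [subOrder_iff]
  have hg : ∀ k, ∃ k₁, e (inK K (.leaf A) k) = inK K₁ (.leaf A) k₁ := by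
    intro k
    rcases in_surj K₁ (.leaf A) (e (inK K (.leaf A) k)) with h | ⟨q, hq⟩
    · exact h
    · exfalso
      have hq' : q = sU A := rfl
      rw [hq', hp] at hq
      exact inK_ne_inD _ _ _ _ (e.injective hq)
  choose g hg using hg
  have gb : Function.Bijective g := by
    constructor
    · intro k l hkl
      apply inK_inj K (.leaf A)
      apply e.injective
      rw [hg, hg, hkl]
    · intro k₁
      rcases in_surj K (.leaf A) (e.symm (inK K₁ (.leaf A) k₁)) with ⟨k, hk⟩ | ⟨q, hq⟩
      · refine ⟨k, inK_inj K₁ (.leaf A) ?_⟩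
        rw [← hg, ← hk, Equiv.apply_symm_apply]
      · exfalso
        have hq' : q = sU A := rfl
        rw [hq', Equiv.symm_apply_eq, ← hp] at hq
        exact inK_ne_inD _ _ _ _ hq
  let E : SPos (fill K Δ) ≃ SPos (fill K₁ Δ) :=
    (fillEquiv K Δ).symm.trans
      ((Equiv.sumCongr (Equiv.ofBijective g gb) (Equiv.refl _)).trans (fillEquiv K₁ Δ))
  have EK : ∀ k, E (inK K Δ k) = inK K₁ Δ (g k) := by
    intro k
    have : inK K Δ k = fillEquiv K Δ (.inl k) := rfl
    simp only [E, this, Equiv.trans_apply, Equiv.symm_apply_apply]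
    rfl
  have ED : ∀ k, E (inD K Δ k) = inD K₁ Δ k := by
    intro k
    have : inD K Δ k = fillEquiv K Δ (.inr k) := rfl
    simp only [E, this, Equiv.trans_apply, Equiv.symm_apply_apply]
    rfl
  refine ⟨E, fun x => ?_, fun x y hxy => ?_⟩
  · rcases in_surj K Δ x with ⟨k, rfl⟩ | ⟨q, rfl⟩
    · rw [EK, SLab_inK K Δ (.leaf A), SLab_inK K₁ Δ (.leaf A), ← hg, h1]
    · rw [ED, SLab_inD, SLab_inD]
  · rcases in_surj K Δ x with ⟨k, rfl⟩ | ⟨q, rfl⟩ <;>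
      rcases in_surj K Δ y with ⟨l, rfl⟩ | ⟨r, rfl⟩
    · rw [EK, EK, SLt_KK K₁ Δ (.leaf A), ← hg, ← hg]
      rw [SLt_KK K Δ (.leaf A)] at hxy
      exact h2 _ _ hxy
    · rw [EK, ED, SLt_KD K₁ Δ (.leaf A) _ _ (sU A), ← hg, hp]
      rw [SLt_KD K Δ (.leaf A) _ _ (sU A)] at hxy
      exact h2 _ _ hxy
    · rw [EK, ED, SLt_DK K₁ Δ (.leaf A) _ _ (sU A), ← hg, hp]
      rw [SLt_DK K Δ (.leaf A) _ _ (sU A)] at hxy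
      exact h2 _ _ hxy
    · rw [ED, ED, SLt_DD]
      rwa [SLt_DD] at hxy

theorem fill_ccomp (K K' : CCtx) (Δ : Ctx) : fill (ccomp K K') Δ = fill K (fill K' Δ) := by
  induction K with
  | hole => rfl
  | _ => simp_all [ccomp, fill]

theorem fill_decomp (K₀ K : CCtx) (Δ₀ : Ctx) (X : Fm) (h : fill K₀ Δ₀ = fill K (.leaf X)) :
    (∃ K₁, K = ccomp K₀ K₁ ∧ Δ₀ = fill K₁ (.leaf X)) ∨
    ∃ K1 K2 : Ctx → CCtx, (∀ D, fill K₀ D = fill (K1 D) (.leaf X)) ∧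
      (∀ D Δ, fill (K2 Δ) D = fill (K1 D) Δ) ∧ ∀ Δ, fill K Δ = fill (K2 Δ) Δ₀ := by
  induction K₀ generalizing K with
  | hole => exact .inl ⟨K, rfl, h⟩
  | seqL K₀ b ih =>
    cases K <;> simp only [fill, Ctx.seq.injEq, reduceCtorEq] at h
    · rename_i K c
      obtain ⟨h, rfl⟩ := h
      rcases ih K h with ⟨K₁, rfl, hk⟩ | ⟨K1, K2, a1, a2, a3⟩
      · exact .inl ⟨K₁, rfl, hk⟩
      · exact .inr ⟨fun D => .seqL (K1 D) b, fun D => .seqL (K2 D) b, by simp [fill, a1],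
          by simp [fill, a2], by simp [fill, a3]⟩
    · rename_i c K
      obtain ⟨rfl, rfl⟩ := h
      exact .inr ⟨fun D => .seqR (fill K₀ D) K, fun D => .seqL K₀ (fill K D), by simp [fill],
          by simp [fill], by simp [fill]⟩
  | seqR b K₀ ih =>
    cases K <;> simp only [fill, Ctx.seq.injEq, reduceCtorEq] at h
    · rename_i K c
      obtain ⟨rfl, rfl⟩ := h
      exact .inr ⟨fun D => .seqL K (fill K₀ D), fun D => .seqR (fill K D) K₀, by simp [fill],
          by simp [fill], by simp [fill]⟩
    · rename_i c K
      obtain ⟨rfl, h⟩ := h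
      rcases ih K h with ⟨K₁, rfl, hk⟩ | ⟨K1, K2, a1, a2, a3⟩
      · exact .inl ⟨K₁, rfl, hk⟩
      · exact .inr ⟨fun D => .seqR b (K1 D), fun D => .seqR b (K2 D), by simp [fill, a1],
          by simp [fill, a2], by simp [fill, a3]⟩
  | parL K₀ b ih =>
    cases K <;> simp only [fill, Ctx.par.injEq, reduceCtorEq] at h
    · rename_i K c
      obtain ⟨h, rfl⟩ := h
      rcases ih K h with ⟨K₁, rfl, hk⟩ | ⟨K1, K2, a1, a2, a3⟩
      · exact .inl ⟨K₁, rfl, hk⟩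
      · exact .inr ⟨fun D => .parL (K1 D) b, fun D => .parL (K2 D) b, by simp [fill, a1],
          by simp [fill, a2], by simp [fill, a3]⟩
    · rename_i c K
      obtain ⟨rfl, rfl⟩ := h
      exact .inr ⟨fun D => .parR (fill K₀ D) K, fun D => .parL K₀ (fill K D), by simp [fill],
          by simp [fill], by simp [fill]⟩
  | parR b K₀ ih =>
    cases K <;> simp only [fill, Ctx.par.injEq, reduceCtorEq] at h
    · rename_i K c
      obtain ⟨rfl, rfl⟩ := h
      exact .inr ⟨fun D => .parL K (fill K₀ D), fun D => .parR (fill K D) K₀, by simp [fill],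
          by simp [fill], by simp [fill]⟩
    · rename_i c K
      obtain ⟨rfl, h⟩ := h
      rcases ih K h with ⟨K₁, rfl, hk⟩ | ⟨K1, K2, a1, a2, a3⟩
      · exact .inl ⟨K₁, rfl, hk⟩
      · exact .inr ⟨fun D => .parR b (K1 D), fun D => .parR b (K2 D), by simp [fill, a1],
          by simp [fill, a2], by simp [fill, a3]⟩

theorem seq_decomp {a b : Ctx} {K : CCtx} {X : Fm} (h : Ctx.seq a b = fill K (.leaf X)) :
    (∃ K', K = .seqL K' b ∧ a = fill K' (.leaf X)) ∨
    (∃ K', K = .seqR a K' ∧ b = fill K' (.leaf X)) := by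
  cases K <;> simp_all [fill]

theorem par_decomp {a b : Ctx} {K : CCtx} {X : Fm} (h : Ctx.par a b = fill K (.leaf X)) :
    (∃ K', K = .parL K' b ∧ a = fill K' (.leaf X)) ∨
    (∃ K', K = .parR a K' ∧ b = fill K' (.leaf X)) := by
  cases K <;> simp_all [fill]

theorem subst_exists {Γ : Ctx} {C : Fm} (d : PDeriv Γ C) :
    ∀ (K : CCtx) (X : Fm) (Δ : Ctx) (e : PDeriv Δ X) (Γ' : Ctx),
      Γ = fill K (.leaf X) → Γ' = fill K Δ →
      ∃ d' : PDeriv Γ' C, PSubst ⟨Γ, C, d⟩ ⟨Δ, X, e⟩ ⟨Γ', C, d'⟩ ∧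
        psize d' + 1 = psize d + psize e := by
  induction d with
  | ax A =>
    intro K X Δ e Γ' h h'
    cases K <;> simp only [fill, reduceCtorEq, Ctx.leaf.injEq] at h h'
    subst h h'
    exact ⟨e, .ax e, by simp only [psize]; omega⟩
  | ldivE d₁ d₂ ih₁ ih₂ =>
    intro K X Δ e Γ' h h'
    rcases seq_decomp h with ⟨K', rfl, hk⟩ | ⟨K', rfl, hk⟩
    · obtain ⟨d', hs, hz⟩ := ih₁ K' X Δ e _ hk rfl
      subst h'
      exact ⟨.ldivE d' d₂, .ldivE_l hs, by simp only [psize]; omega⟩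
    · obtain ⟨d', hs, hz⟩ := ih₂ K' X Δ e _ hk rfl
      subst h'
      exact ⟨.ldivE d₁ d', .ldivE_r hs, by simp only [psize]; omega⟩
  | rdivE d₁ d₂ ih₁ ih₂ =>
    intro K X Δ e Γ' h h'
    rcases seq_decomp h with ⟨K', rfl, hk⟩ | ⟨K', rfl, hk⟩
    · obtain ⟨d', hs, hz⟩ := ih₁ K' X Δ e _ hk rfl
      subst h'
      exact ⟨.rdivE d' d₂, .rdivE_l hs, by simp only [psize]; omega⟩
    · obtain ⟨d', hs, hz⟩ := ih₂ K' X Δ e _ hk rfl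
      subst h'
      exact ⟨.rdivE d₁ d', .rdivE_r hs, by simp only [psize]; omega⟩
  | limpE d₁ d₂ ih₁ ih₂ =>
    intro K X Δ e Γ' h h'
    rcases par_decomp h with ⟨K', rfl, hk⟩ | ⟨K', rfl, hk⟩
    · obtain ⟨d', hs, hz⟩ := ih₁ K' X Δ e _ hk rfl
      subst h'
      exact ⟨.limpE d' d₂, .limpE_l hs, by simp only [psize]; omega⟩
    · obtain ⟨d', hs, hz⟩ := ih₂ K' X Δ e _ hk rfl
      subst h'
      exact ⟨.limpE d₁ d', .limpE_r hs, by simp only [psize]; omega⟩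
  | @ldivI Γ A C d ih =>
    intro K X Δ e Γ' h h'
    obtain ⟨d', hs, hz⟩ := ih (.seqR (.leaf A) K) X Δ e (.seq (.leaf A) Γ')
      (by simp [fill, h]) (by simp [fill, h'])
    exact ⟨.ldivI d', .ldivI hs, by simp only [psize]; omega⟩
  | @rdivI Γ A C d ih =>
    intro K X Δ e Γ' h h'
    obtain ⟨d', hs, hz⟩ := ih (.seqL K (.leaf A)) X Δ e (.seq Γ' (.leaf A))
      (by simp [fill, h]) (by simp [fill, h'])
    exact ⟨.rdivI d', .rdivI hs, by simp only [psize]; omega⟩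
  | @limpI Γ A C d ih =>
    intro K X Δ e Γ' h h'
    obtain ⟨d', hs, hz⟩ := ih (.parR (.leaf A) K) X Δ e (.par (.leaf A) Γ')
      (by simp [fill, h]) (by simp [fill, h'])
    exact ⟨.limpI d', .limpI hs, by simp only [psize]; omega⟩
  | nprodI d₁ d₂ ih₁ ih₂ =>
    intro K X Δ e Γ' h h'
    rcases seq_decomp h with ⟨K', rfl, hk⟩ | ⟨K', rfl, hk⟩
    · obtain ⟨d', hs, hz⟩ := ih₁ K' X Δ e _ hk rfl
      subst h'
      exact ⟨.nprodI d' d₂, .nprodI_l hs, by simp only [psize]; omega⟩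
    · obtain ⟨d', hs, hz⟩ := ih₂ K' X Δ e _ hk rfl
      subst h'
      exact ⟨.nprodI d₁ d', .nprodI_r hs, by simp only [psize]; omega⟩
  | cprodI d₁ d₂ ih₁ ih₂ =>
    intro K X Δ e Γ' h h'
    rcases par_decomp h with ⟨K', rfl, hk⟩ | ⟨K', rfl, hk⟩
    · obtain ⟨d', hs, hz⟩ := ih₁ K' X Δ e _ hk rfl
      subst h'
      exact ⟨.cprodI d' d₂, .cprodI_l hs, by simp only [psize]; omega⟩
    · obtain ⟨d', hs, hz⟩ := ih₂ K' X Δ e _ hk rfl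
      subst h'
      exact ⟨.cprodI d₁ d', .cprodI_r hs, by simp only [psize]; omega⟩
  | @nprodE Δ₀ A B K₀ C d₀ dr ih₀ ihr =>
    intro K X Δ e Γ' h h'
    rcases fill_decomp _ _ _ _ h with ⟨K₁, rfl, hk⟩ | ⟨K1, K2, a1, a2, a3⟩
    · obtain ⟨d', hs, hz⟩ := ih₀ K₁ X Δ e _ hk rfl
      rw [fill_ccomp] at h'
      subst h'
      exact ⟨.nprodE d' dr, .nprodE_l hs, by simp only [psize]; omega⟩
    · obtain ⟨d', hs, hz⟩ := ihr (K1 _) X Δ e _ (a1 _) (a2 _ _)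
      rw [a3] at h'
      subst h'
      exact ⟨.nprodE d₀ d', .nprodE_r hs, by simp only [psize]; omega⟩
  | @cprodE Δ₀ A B K₀ C d₀ dr ih₀ ihr =>
    intro K X Δ e Γ' h h'
    rcases fill_decomp _ _ _ _ h with ⟨K₁, rfl, hk⟩ | ⟨K1, K2, a1, a2, a3⟩
    · obtain ⟨d', hs, hz⟩ := ih₀ K₁ X Δ e _ hk rfl
      rw [fill_ccomp] at h'
      subst h'
      exact ⟨.cprodE d' dr, .cprodE_l hs, by simp only [psize]; omega⟩
    · obtain ⟨d', hs, hz⟩ := ihr (K1 _) X Δ e _ (a1 _) (a2 _ _)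
      rw [a3] at h'
      subst h'
      exact ⟨.cprodE d₀ d', .cprodE_r hs, by simp only [psize]; omega⟩
  | @entropy Γ₀ Γ₁ C d hsub ih =>
    intro K X Δ e Γ' h h'
    subst h h'
    obtain ⟨K₁, hk, hs'⟩ := subOrder_subst K X Γ₀ Δ hsub
    obtain ⟨d', hs, hz⟩ := ih K₁ X Δ e _ hk rfl
    exact ⟨.entropy d' hs', .entropy hsub hs' hs, by simp only [psize]; omega⟩

/-- Subject reduction for redex contraction in PCMLL:
contracting any of the seven redexes yields a derivation of the same sequent
with strictly fewer rules:
(1) `\ᵢ` immediately followed by `\ₑ`; (2) `/ᵢ` followed by `/ₑ`;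
(3) `⊸ᵢ` followed by `⊸ₑ`; (4) `⊙ᵢ` as the left premise of `⊙ₑ`;
(5) `⊗ᵢ` as the left premise of `⊗ₑ`; (6) `⊙ᵢ` applied to two axioms as the
right premise of `⊙ₑ`; (7) `⊗ᵢ` applied to two axioms as the right premise
of `⊗ₑ`. -/
theorem subject_reduction_PCMLL :
    (∀ (Γ Δ : Ctx) (A C : Fm) (δ₁ : PDeriv Δ A)
       (δ : PDeriv (Ctx.seq (.leaf A) Γ) C),
       ∃ d' : PDeriv (Ctx.seq Δ Γ) C,
         PSubst ⟨Ctx.seq (.leaf A) Γ, C, δ⟩ ⟨Δ, A, δ₁⟩ ⟨Ctx.seq Δ Γ, C, d'⟩ ∧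
         psize d' < psize (PDeriv.ldivE δ₁ (PDeriv.ldivI δ))) ∧
    (∀ (Γ Δ : Ctx) (A C : Fm) (δ₁ : PDeriv Δ A)
       (δ : PDeriv (Ctx.seq Γ (.leaf A)) C),
       ∃ d' : PDeriv (Ctx.seq Γ Δ) C,
         PSubst ⟨Ctx.seq Γ (.leaf A), C, δ⟩ ⟨Δ, A, δ₁⟩ ⟨Ctx.seq Γ Δ, C, d'⟩ ∧
         psize d' < psize (PDeriv.rdivE (PDeriv.rdivI δ) δ₁)) ∧
    (∀ (Γ Δ : Ctx) (A C : Fm) (δ₁ : PDeriv Δ A)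
       (δ : PDeriv (Ctx.par (.leaf A) Γ) C),
       ∃ d' : PDeriv (Ctx.par Δ Γ) C,
         PSubst ⟨Ctx.par (.leaf A) Γ, C, δ⟩ ⟨Δ, A, δ₁⟩ ⟨Ctx.par Δ Γ, C, d'⟩ ∧
         psize d' < psize (PDeriv.limpE δ₁ (PDeriv.limpI δ))) ∧
    (∀ (Δ₁ Δ₂ : Ctx) (A B C : Fm) (K : CCtx)
       (δ₁ : PDeriv Δ₁ A) (δ₂ : PDeriv Δ₂ B)
       (δr : PDeriv (fill K (Ctx.seq (.leaf A) (.leaf B))) C),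
       ∃ (d₁' : PDeriv (fill K (Ctx.seq Δ₁ (.leaf B))) C)
         (d₂' : PDeriv (fill K (Ctx.seq Δ₁ Δ₂)) C),
         PSubst ⟨fill K (Ctx.seq (.leaf A) (.leaf B)), C, δr⟩ ⟨Δ₁, A, δ₁⟩
           ⟨fill K (Ctx.seq Δ₁ (.leaf B)), C, d₁'⟩ ∧
         PSubst ⟨fill K (Ctx.seq Δ₁ (.leaf B)), C, d₁'⟩ ⟨Δ₂, B, δ₂⟩
           ⟨fill K (Ctx.seq Δ₁ Δ₂), C, d₂'⟩ ∧
         psize d₂' < psize (PDeriv.nprodE (PDeriv.nprodI δ₁ δ₂) δr)) ∧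
    (∀ (Δ₁ Δ₂ : Ctx) (A B C : Fm) (K : CCtx)
       (δ₁ : PDeriv Δ₁ A) (δ₂ : PDeriv Δ₂ B)
       (δr : PDeriv (fill K (Ctx.par (.leaf A) (.leaf B))) C),
       ∃ (d₁' : PDeriv (fill K (Ctx.par Δ₁ (.leaf B))) C)
         (d₂' : PDeriv (fill K (Ctx.par Δ₁ Δ₂)) C),
         PSubst ⟨fill K (Ctx.par (.leaf A) (.leaf B)), C, δr⟩ ⟨Δ₁, A, δ₁⟩
           ⟨fill K (Ctx.par Δ₁ (.leaf B)), C, d₁'⟩ ∧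
         PSubst ⟨fill K (Ctx.par Δ₁ (.leaf B)), C, d₁'⟩ ⟨Δ₂, B, δ₂⟩
           ⟨fill K (Ctx.par Δ₁ Δ₂), C, d₂'⟩ ∧
         psize d₂' < psize (PDeriv.cprodE (PDeriv.cprodI δ₁ δ₂) δr)) ∧
    (∀ (Δ : Ctx) (A B : Fm) (δ₀ : PDeriv Δ (Fm.nprod A B)),
       (∃ δ' : PDeriv (fill CCtx.hole Δ) (Fm.nprod A B), δ' = δ₀) ∧
       psize δ₀ < psize (PDeriv.nprodE (K := CCtx.hole) δ₀
         (PDeriv.nprodI (.ax A) (.ax B)))) ∧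
    (∀ (Δ : Ctx) (A B : Fm) (δ₀ : PDeriv Δ (Fm.cprod A B)),
       (∃ δ' : PDeriv (fill CCtx.hole Δ) (Fm.cprod A B), δ' = δ₀) ∧
       psize δ₀ < psize (PDeriv.cprodE (K := CCtx.hole) δ₀
         (PDeriv.cprodI (.ax A) (.ax B)))) := by
  refine ⟨?_, ?_, ?_, ?_, ?_, ?_, ?_⟩
  · intro Γ Δ A C δ₁ δ
    obtain ⟨d', hs, hz⟩ := subst_exists δ (.seqL .hole Γ) A Δ δ₁ (.seq Δ Γ) rfl rfl
    exact ⟨d', hs, by simp only [psize]; omega⟩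
  · intro Γ Δ A C δ₁ δ
    obtain ⟨d', hs, hz⟩ := subst_exists δ (.seqR Γ .hole) A Δ δ₁ (.seq Γ Δ) rfl rfl
    exact ⟨d', hs, by simp only [psize]; omega⟩
  · intro Γ Δ A C δ₁ δ
    obtain ⟨d', hs, hz⟩ := subst_exists δ (.parL .hole Γ) A Δ δ₁ (.par Δ Γ) rfl rfl
    exact ⟨d', hs, by simp only [psize]; omega⟩
  · intro Δ₁ Δ₂ A B C K δ₁ δ₂ δr
    obtain ⟨d₁', hs, hz⟩ := subst_exists δr (ccomp K (.seqL .hole (.leaf B))) A Δ₁ δ₁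
      (fill K (Ctx.seq Δ₁ (.leaf B))) (by rw [fill_ccomp]; rfl) (by rw [fill_ccomp]; rfl)
    obtain ⟨d₂', hs', hz'⟩ := subst_exists d₁' (ccomp K (.seqR Δ₁ .hole)) B Δ₂ δ₂
      (fill K (Ctx.seq Δ₁ Δ₂)) (by rw [fill_ccomp]; rfl) (by rw [fill_ccomp]; rfl)
    exact ⟨d₁', d₂', hs, hs', by simp only [psize]; omega⟩
  · intro Δ₁ Δ₂ A B C K δ₁ δ₂ δr
    obtain ⟨d₁', hs, hz⟩ := subst_exists δr (ccomp K (.parL .hole (.leaf B))) A Δ₁ δ₁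
      (fill K (Ctx.par Δ₁ (.leaf B))) (by rw [fill_ccomp]; rfl) (by rw [fill_ccomp]; rfl)
    obtain ⟨d₂', hs', hz'⟩ := subst_exists d₁' (ccomp K (.parR Δ₁ .hole)) B Δ₂ δ₂
      (fill K (Ctx.par Δ₁ Δ₂)) (by rw [fill_ccomp]; rfl) (by rw [fill_ccomp]; rfl)
    exact ⟨d₁', d₂', hs, hs', by simp only [psize]; omega⟩
  · intro Δ A B δ₀
    exact ⟨⟨δ₀, rfl⟩, by simp only [psize]; omega⟩
  · intro Δ A B δ₀
    exact ⟨⟨δ₀, rfl⟩, by simp only [psize]; omega⟩
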